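/- Let λ, χ, ψ ∈ ℝ satisfy: (χ ≥ 0 and ψ > 0) if λ > 0; (χ > 0 and ψ > 0) if λ = 0; (χ > 0 and ψ ≥ 0) if λ < 0. Let μ, β ∈ ℝ with β² + ψ > 0 or λ < 1/2, and define f : ℝ → [0,∞] by f(y) = ∫₀^∞ (2πx)^{-1/2} · exp(−(y − μ − βx)²/(2x)) · x^{λ−1} exp(−(χ/x + ψx)/2) dx. Then f is log-convex on (−∞, μ) and log-convex on (μ, ∞) if and only if χ = 0 and 0 < λ ≤ 1. -/

import Mathlib

open MeasureTheory Set Real ENNReal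

noncomputable def GG (p c d x : ℝ) : ℝ := x ^ p * Real.exp (-(c / x) - d * x)

lemma GG_meas (p c d : ℝ) : Measurable (GG p c d) := by
  unfold GG; fun_prop

lemma GG_pos (p c d x : ℝ) (hx : 0 < x) : 0 < GG p c d x := by
  unfold GG; positivity

lemma exp_neg_le_pow (n : ℕ) (t : ℝ) (ht : 0 < t) : Real.exp (-t) ≤ n.factorial / t ^ n := by
  have := Real.pow_div_factorial_le_exp t ht.le n
  rw [Real.exp_neg, inv_le_comm₀ (Real.exp_pos _) (by positivity), inv_div]
  exact this

lemma GG_int (p c d : ℝ) (hc : 0 ≤ c) (hd : 0 ≤ d) (h1 : 0 < c ∨ -1 < p) (h2 : 0 < d ∨ p < -1) :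
    IntegrableOn (GG p c d) (Ioi 0) := by
  rw [← Ioc_union_Ioi_eq_Ioi (zero_le_one (α := ℝ))]
  apply IntegrableOn.union
  · obtain ⟨q, C, hq, hb⟩ : ∃ q C : ℝ, -1 < q ∧ ∀ x ∈ Ioc (0:ℝ) 1, GG p c d x ≤ C * x ^ q := by
      rcases h1 with h | h
      · obtain ⟨n, hn⟩ := exists_nat_gt (-1 - p)
        refine ⟨p + n, n.factorial / c ^ n, by linarith, fun x hx => ?_⟩
        have hx0 : 0 < x := hx.1
        have h3 : Real.exp (-(c / x) - d * x) ≤ n.factorial / (c / x) ^ n :=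
          le_trans (Real.exp_le_exp.2 (by nlinarith [mul_nonneg hd hx0.le]))
            (exp_neg_le_pow n (c / x) (by positivity))
        unfold GG
        calc _ ≤ x ^ p * (n.factorial / (c / x) ^ n) := by gcongr
          _ = _ := by
            rw [Real.rpow_add hx0, Real.rpow_natCast, div_pow]; field_simp
      · refine ⟨p, 1, h, fun x hx => ?_⟩
        have hx0 : 0 < x := hx.1
        unfold GG
        have : Real.exp (-(c / x) - d * x) ≤ 1 := by
          apply Real.exp_le_one_iff.2
          have : 0 ≤ c / x := by positivity
          nlinarith [mul_nonneg hd hx0.le]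
        have := mul_le_mul_of_nonneg_left this (Real.rpow_nonneg hx0.le p)
        linarith
    have hi : IntegrableOn (fun x : ℝ => C * x ^ q) (Ioc 0 1) := by
      have := (intervalIntegral.intervalIntegrable_rpow' (a := 0) (b := 1) hq)
      rw [intervalIntegrable_iff_integrableOn_Ioc_of_le zero_le_one] at this
      exact this.const_mul C
    refine Integrable.mono' hi (GG_meas _ _ _).aestronglyMeasurable ?_
    refine (ae_restrict_iff' measurableSet_Ioc).2 (ae_of_all _ fun x hx => ?_)
    rw [Real.norm_of_nonneg (GG_pos _ _ _ _ hx.1).le]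
    exact hb x hx
  · obtain ⟨q, C, hq, hb⟩ : ∃ q C : ℝ, q < -1 ∧ ∀ x ∈ Ioi (1:ℝ), GG p c d x ≤ C * x ^ q := by
      rcases h2 with h | h
      · obtain ⟨n, hn⟩ := exists_nat_gt (1 + p)
        refine ⟨p - n, n.factorial / d ^ n, by linarith, fun x hx => ?_⟩
        have hx0 : 0 < x := lt_trans one_pos hx
        have h3 : Real.exp (-(c / x) - d * x) ≤ n.factorial / (d * x) ^ n :=
          le_trans (Real.exp_le_exp.2 (by have : 0 ≤ c / x := by positivity
                                          linarith))
            (exp_neg_le_pow n (d * x) (by positivity))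
        unfold GG
        calc _ ≤ x ^ p * (n.factorial / (d * x) ^ n) := by gcongr
          _ = _ := by
            rw [Real.rpow_sub hx0, Real.rpow_natCast, mul_pow]; field_simp
      · refine ⟨p, 1, h, fun x hx => ?_⟩
        have hx0 : 0 < x := lt_trans one_pos hx
        unfold GG
        have : Real.exp (-(c / x) - d * x) ≤ 1 := by
          apply Real.exp_le_one_iff.2
          have : 0 ≤ c / x := by positivity
          nlinarith [mul_nonneg hd hx0.le]
        have := mul_le_mul_of_nonneg_left this (Real.rpow_nonneg hx0.le p)
        linarith
    have hi : IntegrableOn (fun x : ℝ => C * x ^ q) (Ioi 1) :=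
      (integrableOn_Ioi_rpow_of_lt hq one_pos).const_mul C
    refine Integrable.mono' hi (GG_meas _ _ _).aestronglyMeasurable ?_
    refine (ae_restrict_iff' measurableSet_Ioi).2 (ae_of_all _ fun x hx => ?_)
    rw [Real.norm_of_nonneg (GG_pos _ _ _ _ (lt_trans one_pos hx)).le]
    exact hb x hx

noncomputable def HH (p c d : ℝ) : ℝ≥0∞ := ∫⁻ x in Ioi (0:ℝ), ENNReal.ofReal (GG p c d x)

lemma HH_pos (p c d : ℝ) : 0 < HH p c d := by
  unfold HH
  rw [setLIntegral_pos_iff (GG_meas _ _ _).ennreal_ofReal]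
  have : Function.support (fun x => ENNReal.ofReal (GG p c d x)) ∩ Ioi 0 = Ioi 0 := by
    apply inter_eq_right.2
    intro x hx
    simpa using GG_pos p c d x hx
  rw [this]; simp

lemma HH_eq (p c d : ℝ) (h : IntegrableOn (GG p c d) (Ioi 0)) :
    HH p c d = ENNReal.ofReal (∫ x in Ioi (0:ℝ), GG p c d x) := by
  unfold HH
  rw [ofReal_integral_eq_lintegral_ofReal h]
  exact (ae_restrict_iff' measurableSet_Ioi).2 (ae_of_all _ fun x hx => (GG_pos _ _ _ _ hx).le)

/-- reduction of the integrand -/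
lemma f_eq (lam χ ψ μ β y : ℝ) :
    (∫⁻ x in Ioi (0:ℝ), ENNReal.ofReal
      ((2 * π * x) ^ (-(1:ℝ)/2) * Real.exp (-(y - μ - β * x) ^ 2 / (2 * x)) *
        (x ^ (lam - 1) * Real.exp (-(χ / x + ψ * x) / 2)))) =
    ENNReal.ofReal ((2 * π) ^ (-(1:ℝ)/2) * Real.exp (β * (y - μ))) *
      HH (lam - 3/2) ((χ + (y - μ)^2) / 2) ((ψ + β^2) / 2) := by
  unfold HH
  rw [← lintegral_const_mul _ (GG_meas _ _ _).ennreal_ofReal]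
  refine setLIntegral_congr_fun measurableSet_Ioi fun x hx => ?_
  have hx0 : 0 < x := hx
  rw [← ENNReal.ofReal_mul (by positivity)]
  congr 1
  unfold GG
  rw [Real.mul_rpow (by positivity) hx0.le, show lam - 3/2 = -(1:ℝ)/2 + (lam - 1) by ring,
    Real.rpow_add hx0]
  have : Real.exp (-(y - μ - β * x) ^ 2 / (2 * x)) * Real.exp (-(χ / x + ψ * x) / 2) =
      Real.exp (β * (y - μ)) *
        Real.exp (-((χ + (y - μ)^2) / 2 / x) - (ψ + β^2) / 2 * x) := by
    rw [← Real.exp_add, ← Real.exp_add]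
    congr 1
    field_simp
    ring
  linear_combination ((2 * π) ^ (-(1:ℝ)/2) * x ^ (-(1:ℝ)/2) * x ^ (lam - 1)) * this

/-- abstract log-convexity contradiction -/
lemma contra (h : ℝ → ℝ) (C r : ℝ) (hr : 1 < r) (hpos : ∀ u, 0 < h u) (hle : ∀ u, h u ≤ h 0)
    (h1 : h 1 < h 0) (hC : ∀ u, 0 < u → h 0 - h u ≤ C * u ^ r)
    (hcv : ∀ u₁ > 0, ∀ u₂ > 0, ∀ θ ∈ Ioo (0:ℝ) 1,
      h (θ * u₁ + (1 - θ) * u₂) ≤ h u₁ ^ θ * h u₂ ^ (1 - θ)) : False := by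
  set m : ℝ := (Real.log (h 0) - Real.log (h 1)) / 2 with hm
  have hm0 : 0 < m := by have := Real.log_lt_log (hpos 1) h1; linarith
  have key : ∀ u ∈ Ioo (0:ℝ) 1, h u * (1 + m * u) ≤ h 0 := by
    intro u hu
    obtain ⟨hu0, hu1⟩ := hu
    have hd : 0 < 1 - u / 2 := by linarith
    have hd2 : 2 - u ≠ 0 := by linarith
    set θ := (1 - u) / (1 - u / 2) with hθ
    have hθ0 : 0 < θ := div_pos (by linarith) hd
    have hθ1 : 1 - θ = (u / 2) / (1 - u / 2) := by rw [hθ]; field_simp; ring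
    have h1θ : u / 2 ≤ 1 - θ := by
      rw [hθ1, le_div_iff₀ hd]; nlinarith
    have := hcv (u/2) (by linarith) 1 one_pos θ ⟨hθ0, by linarith⟩
    have e : θ * (u / 2) + (1 - θ) * 1 = u := by rw [hθ1, hθ]; field_simp; ring
    rw [e] at this
    have l := Real.log_le_log (hpos u) this
    rw [Real.log_mul (Real.rpow_pos_of_pos (hpos _) _).ne' (Real.rpow_pos_of_pos (hpos _) _).ne',
      Real.log_rpow (hpos _), Real.log_rpow (hpos _)] at l
    have l2 := Real.log_le_log (hpos (u/2)) (hle (u/2))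
    have l3 : Real.log (h u) + m * u ≤ Real.log (h 0) := by
      have a1 := mul_le_mul_of_nonneg_left l2 hθ0.le
      have a2 := mul_le_mul_of_nonneg_right h1θ hm0.le
      have : Real.log (h 1) = Real.log (h 0) - 2 * m := by rw [hm]; ring
      rw [this] at l
      nlinarith
    have l4 := Real.exp_le_exp.2 l3
    rw [Real.exp_add, Real.exp_log (hpos _), Real.exp_log (hpos _)] at l4
    have := Real.add_one_le_exp (m * u)
    nlinarith [hpos u]
  have key2 : ∀ u ∈ Ioo (0:ℝ) 1, m * h 0 ≤ C * (1 + m) * u ^ (r - 1) := by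
    intro u hu
    have k := key u hu
    have c := hC u hu.1
    have e : u ^ r = u ^ (r - 1) * u := by
      rw [← Real.rpow_add_one hu.1.ne']; congr 1; ring
    rw [e] at c
    have hp : 0 < u ^ (r - 1) := Real.rpow_pos_of_pos hu.1 _
    have c0 : 0 ≤ C * u ^ (r-1) := by
      have : 0 ≤ (C * u ^ (r-1)) * u := by linarith [hle u]
      exact nonneg_of_mul_nonneg_left this hu.1
    have s1 : m * h 0 * u ≤ (C * u ^ (r-1)) * (1 + m * u) * u := by
      have : 0 ≤ 1 + m * u := by nlinarith [hu.1]
      nlinarith [mul_le_mul_of_nonneg_right c this]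
    have s2 := le_of_mul_le_mul_right s1 hu.1
    have : m * u ≤ m := by nlinarith [hu.2]
    nlinarith
  have lim : Filter.Tendsto (fun u : ℝ => C * (1 + m) * u ^ (r - 1)) (nhdsWithin 0 (Ioi 0))
      (nhds 0) := by
    have : ContinuousAt (fun u : ℝ => C * (1 + m) * u ^ (r - 1)) 0 :=
      (Real.continuousAt_rpow_const _ _ (Or.inr (by linarith))).const_mul _
    have t := this.tendsto
    simp only [Real.zero_rpow (by linarith : r - 1 ≠ 0), mul_zero] at t
    exact t.mono_left nhdsWithin_le_nhds
  have := ge_of_tendsto lim (Filter.mem_of_superset (Ioo_mem_nhdsGT one_pos) key2)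
  nlinarith [hpos 0, mul_pos hm0 (hpos 0)]

lemma one_sub_exp_le (t s : ℝ) (ht : 0 ≤ t) (hs0 : 0 ≤ s) (hs : s ≤ 1) :
    1 - Real.exp (-t) ≤ t ^ s := by
  rcases le_total t 1 with h | h
  · have h1 := Real.add_one_le_exp (-t)
    have h2 : t ≤ t ^ s := by
      rcases ht.eq_or_lt with h0 | h0
      · rw [← h0]; positivity
      · simpa using Real.rpow_le_rpow_of_exponent_ge h0 h hs
    linarith
  · have := Real.one_le_rpow h hs0
    have := Real.exp_pos (-t)
    linarith

lemma GG_split (p χ d u x : ℝ) :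
    GG p ((χ + u^2) / 2) d x = GG p (χ / 2) d x * Real.exp (-(u^2 / 2 / x)) := by
  unfold GG
  rw [mul_assoc, ← Real.exp_add]
  congr 2
  ring

lemma nec (p χ d r : ℝ) (hr : 1 < r) (hr2 : r ≤ 2)
    (hi : IntegrableOn (GG p (χ / 2) d) (Ioi 0))
    (hi2 : IntegrableOn (GG (p - r / 2) (χ / 2) d) (Ioi 0))
    (hcv : ∀ u₁ > 0, ∀ u₂ > 0, ∀ θ ∈ Ioo (0:ℝ) 1,
      HH p ((χ + (θ * u₁ + (1 - θ) * u₂)^2) / 2) d ≤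
        HH p ((χ + u₁^2) / 2) d ^ θ * HH p ((χ + u₂^2) / 2) d ^ (1 - θ)) : False := by
  have hle : ∀ u x, 0 < x → GG p ((χ + u^2) / 2) d x ≤ GG p (χ / 2) d x := by
    intro u x hx
    rw [GG_split]
    apply mul_le_of_le_one_right (GG_pos _ _ _ _ hx).le
    apply Real.exp_le_one_iff.2
    have : 0 ≤ u^2 / 2 / x := by positivity
    linarith
  have hint : ∀ u, IntegrableOn (GG p ((χ + u^2) / 2) d) (Ioi 0) := by
    intro u
    refine Integrable.mono' hi (GG_meas _ _ _).aestronglyMeasurable ?_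
    refine (ae_restrict_iff' measurableSet_Ioi).2 (ae_of_all _ fun x hx => ?_)
    rw [Real.norm_of_nonneg (GG_pos _ _ _ _ hx).le]
    exact hle u x hx
  set h : ℝ → ℝ := fun u => ∫ x in Ioi (0:ℝ), GG p ((χ + u^2) / 2) d x with hh
  have hH : ∀ u, HH p ((χ + u^2) / 2) d = ENNReal.ofReal (h u) := fun u => HH_eq _ _ _ (hint u)
  have hpos : ∀ u, 0 < h u := by
    intro u
    have := HH_pos p ((χ + u^2) / 2) d
    rw [hH] at this
    simpa using this
  have h0 : h 0 = ∫ x in Ioi (0:ℝ), GG p (χ / 2) d x := by simp [hh]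
  refine contra h (∫ x in Ioi (0:ℝ), GG (p - r / 2) (χ / 2) d x) r hr hpos ?_ ?_ ?_ ?_
  · intro u
    rw [h0]
    exact setIntegral_mono_on (hint u) hi measurableSet_Ioi (fun x hx => hle u x hx)
  · rw [h0, ← sub_pos]
    simp only [hh]
    rw [← integral_sub hi (hint 1), setIntegral_pos_iff_support_of_nonneg_ae]
    · have : Function.support (fun x => GG p (χ / 2) d x - GG p ((χ + 1^2) / 2) d x) ∩ Ioi 0
          = Ioi 0 := by
        apply inter_eq_right.2
        intro x hx
        have hx0 : 0 < x := hx
        rw [Function.mem_support, GG_split]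
        have h1 : Real.exp (-(1^2 / 2 / x)) < 1 := by
          apply Real.exp_lt_one_iff.2
          have : 0 < 1^2 / 2 / x := by positivity
          linarith
        have := GG_pos p (χ / 2) d x hx
        nlinarith
      rw [this]; simp
    · refine (ae_restrict_iff' measurableSet_Ioi).2 (ae_of_all _ fun x hx => ?_)
      have := hle 1 x hx
      simp only [Pi.zero_apply]
      linarith
    · exact hi.sub (hint 1)
  · intro u hu
    rw [h0]
    simp only [hh]
    rw [← integral_sub hi (hint u), ← integral_mul_const]
    refine setIntegral_mono_on (hi.sub (hint u)) (hi2.mul_const _) measurableSet_Ioi ?_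
    intro x hx
    have hx0 : 0 < x := hx
    rw [GG_split]
    have e : GG (p - r/2) (χ / 2) d x * u ^ r = GG p (χ / 2) d x * (u^2 / x) ^ (r/2) := by
      unfold GG
      rw [Real.rpow_sub hx0, Real.div_rpow (by positivity) hx0.le, ← Real.rpow_natCast u 2,
        ← Real.rpow_mul hu.le]
      have : ((2:ℕ):ℝ) * (r / 2) = r := by push_cast; ring
      rw [this]
      ring
    rw [e]
    have k1 := one_sub_exp_le (u^2/2/x) (r/2) (by positivity) (by linarith) (by linarith)
    have k2 : (u^2/2/x) ^ (r/2) ≤ (u^2/x) ^ (r/2) := by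
      apply Real.rpow_le_rpow (by positivity) _ (by linarith)
      gcongr
      nlinarith [sq_nonneg u]
    have := mul_le_mul_of_nonneg_left (k1.trans k2) (GG_pos p (χ / 2) d x hx).le
    linarith
  · intro u₁ h1 u₂ h2 θ hθ
    have := hcv u₁ h1 u₂ h2 θ hθ
    rw [hH, hH, hH, ENNReal.ofReal_rpow_of_pos (hpos _), ENNReal.ofReal_rpow_of_pos (hpos _),
      ← ENNReal.ofReal_mul (Real.rpow_nonneg (hpos _).le _)] at this
    exact (ENNReal.ofReal_le_ofReal_iff
      (mul_nonneg (Real.rpow_nonneg (hpos _).le _) (Real.rpow_nonneg (hpos _).le _))).1 this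

/-- Hölder -/
lemma holder (ν : Measure ℝ) (F₁ F₂ F : ℝ → ℝ≥0∞) (h1 : AEMeasurable F₁ ν)
    (h2 : AEMeasurable F₂ ν) (θ : ℝ) (hθ : θ ∈ Ioo (0:ℝ) 1)
    (h : ∀ᵐ s ∂ν, F s ≤ F₁ s ^ θ * F₂ s ^ (1 - θ)) :
    ∫⁻ s, F s ∂ν ≤ (∫⁻ s, F₁ s ∂ν) ^ θ * (∫⁻ s, F₂ s ∂ν) ^ (1 - θ) :=
  (lintegral_mono_ae h).trans
    (ENNReal.lintegral_mul_norm_pow_le h1 h2 hθ.1.le (by linarith [hθ.2]) (by ring))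

/-- the tilt factor -/
lemma tilt (K β : ℝ) (hK : 0 < K) (u₁ u₂ θ : ℝ) (A A₁ A₂ : ℝ≥0∞) (hθ : θ ∈ Ioo (0:ℝ) 1) :
    (ENNReal.ofReal (K * Real.exp (β * (θ * u₁ + (1 - θ) * u₂))) * A ≤
      (ENNReal.ofReal (K * Real.exp (β * u₁)) * A₁) ^ θ *
      (ENNReal.ofReal (K * Real.exp (β * u₂)) * A₂) ^ (1 - θ)) ↔ A ≤ A₁ ^ θ * A₂ ^ (1 - θ) := by
  have e : ENNReal.ofReal (K * Real.exp (β * (θ * u₁ + (1 - θ) * u₂))) =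
      ENNReal.ofReal (K * Real.exp (β * u₁)) ^ θ *
      ENNReal.ofReal (K * Real.exp (β * u₂)) ^ (1 - θ) := by
    rw [ENNReal.ofReal_rpow_of_pos (by positivity), ENNReal.ofReal_rpow_of_pos (by positivity),
      ← ENNReal.ofReal_mul (by positivity)]
    congr 1
    rw [Real.mul_rpow hK.le (Real.exp_pos _).le, Real.mul_rpow hK.le (Real.exp_pos _).le,
      ← Real.exp_mul, ← Real.exp_mul]
    have k : K ^ θ * K ^ (1 - θ) = K := by
      rw [← Real.rpow_add hK]; simp
    have k2 : Real.exp (β * (θ * u₁ + (1 - θ) * u₂)) =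
      Real.exp (β * u₁ * θ) * Real.exp (β * u₂ * (1 - θ)) := by
      rw [← Real.exp_add]; congr 1; ring
    rw [k2]
    nth_rewrite 1 [← k]
    ring
  rw [ENNReal.mul_rpow_of_nonneg _ _ hθ.1.le, ENNReal.mul_rpow_of_nonneg _ _ (by linarith [hθ.2]),
    mul_mul_mul_comm, ← e]
  apply ENNReal.mul_le_mul_iff_right
  · have : 0 < K * Real.exp (β * (θ * u₁ + (1 - θ) * u₂)) := by positivity
    simpa using this
  · simp

lemma gauss_sub (α κ : ℝ) (hα : 0 < α) (hκ : 0 < κ) :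
    ∫⁻ t : ℝ, ENNReal.ofReal (Real.exp (-t^2)) = ENNReal.ofReal α *
      ∫⁻ x in Ioi (0:ℝ), ENNReal.ofReal ((√x)⁻¹ * Real.exp (-(α * √x - κ / √x)^2)) := by
  set φ : ℝ → ℝ := fun x => α * √x - κ / √x with hφ
  have hder : ∀ x ∈ Ioi (0:ℝ), HasDerivWithinAt φ (α / 2 * (√x)⁻¹ + κ / 2 * ((√x)⁻¹ * x⁻¹)) (Ioi 0) x := by
    intro x hx
    have hx0 : 0 < x := hx
    have h1 := Real.hasDerivAt_sqrt hx0.ne'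
    have hs : 0 < √x := Real.sqrt_pos.2 hx0
    have h2 := (h1.const_mul α).sub ((hasDerivAt_const x κ).div h1 hs.ne')
    refine (h2.congr_deriv ?_).hasDerivWithinAt
    rw [Real.sq_sqrt hx0.le]
    field_simp
    ring
  have hmono : StrictMonoOn φ (Ioi 0) := by
    intro x hx y hy hxy
    have hx0 : 0 < x := hx
    have hs : 0 < √x := Real.sqrt_pos.2 hx0
    have hl := Real.sqrt_lt_sqrt hx0.le hxy
    have : κ / √y < κ / √x := div_lt_div_of_pos_left hκ hs hl
    simp only [hφ]
    nlinarith
  have himg : φ '' Ioi 0 = univ := by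
    apply eq_univ_of_forall
    intro t
    have hq : 0 < t^2 + 4 * α * κ := by positivity
    set q := √(t^2 + 4 * α * κ) with hqd
    have hq2 : q^2 = t^2 + 4 * α * κ := Real.sq_sqrt hq.le
    have hqt : 0 < t + q := by
      have : |t| < q := by
        rw [← Real.sqrt_sq_eq_abs]
        exact Real.sqrt_lt_sqrt (sq_nonneg _) (by nlinarith [mul_pos hα hκ])
      linarith [neg_abs_le t]
    have hw : 0 < (t + q) / (2 * α) := by positivity
    refine ⟨((t + q) / (2 * α))^2, by simp only [mem_Ioi]; positivity, ?_⟩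
    simp only [hφ]
    rw [Real.sqrt_sq hw.le]
    field_simp
    nlinarith
  have S1 := lintegral_image_eq_lintegral_abs_deriv_mul measurableSet_Ioi hder hmono.injOn
    (fun t => ENNReal.ofReal (Real.exp (-t^2)))
  rw [himg, Measure.restrict_univ] at S1
  set A1 := ∫⁻ x in Ioi (0:ℝ), ENNReal.ofReal ((√x)⁻¹ * Real.exp (-(φ x)^2)) with hA1
  set A2 := ∫⁻ x in Ioi (0:ℝ), ENNReal.ofReal (((√x)⁻¹ * x⁻¹) * Real.exp (-(φ x)^2)) with hA2
  have hφm : Measurable φ := by simp only [hφ]; fun_prop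
  have T1 : ∫⁻ t : ℝ, ENNReal.ofReal (Real.exp (-t^2)) =
      ENNReal.ofReal (α / 2) * A1 + ENNReal.ofReal (κ / 2) * A2 := by
    rw [S1, hA1, hA2, ← lintegral_const_mul _ (by fun_prop), ← lintegral_const_mul _ (by fun_prop),
      ← lintegral_add_left (by fun_prop)]
    refine setLIntegral_congr_fun measurableSet_Ioi fun x hx => ?_
    have hx0 : 0 < x := hx
    have hs : 0 < √x := Real.sqrt_pos.2 hx0
    rw [← ENNReal.ofReal_mul (by positivity), ← ENNReal.ofReal_mul (by positivity),
      ← ENNReal.ofReal_mul (by positivity), ← ENNReal.ofReal_add (by positivity) (by positivity),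
      abs_of_pos (by positivity)]
    congr 1
    ring
  have T2 : A2 = ENNReal.ofReal (α / κ) * A1 := by
    set k := κ / α with hk
    have hk0 : 0 < k := by positivity
    have hd2 : ∀ x ∈ Ioi (0:ℝ), HasDerivWithinAt (fun x : ℝ => k^2 / x) (-(k^2 / x^2)) (Ioi 0) x := by
      intro x hx
      have hx0 : 0 < x := hx
      have := ((hasDerivAt_inv hx0.ne').const_mul (k^2))
      refine (this.congr_deriv ?_).hasDerivWithinAt
      field_simp
    have hinj : InjOn (fun x : ℝ => k^2 / x) (Ioi 0) := by
      intro x hx y hy hxy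
      have hx0 : 0 < x := hx
      have hy0 : 0 < y := hy
      simp only at hxy
      field_simp at hxy
      exact hxy.symm
    have him : (fun x : ℝ => k^2 / x) '' Ioi 0 = Ioi 0 := by
      ext y
      constructor
      · rintro ⟨x, hx, rfl⟩
        have hx0 : 0 < x := hx
        simp only [mem_Ioi]; positivity
      · intro hy
        have hy0 : 0 < y := hy
        refine ⟨k^2 / y, by simp only [mem_Ioi]; positivity, ?_⟩
        simp only
        field_simp
    have S2 := lintegral_image_eq_lintegral_abs_deriv_mul measurableSet_Ioi hd2 hinj
      (fun x => ENNReal.ofReal (((√x)⁻¹ * x⁻¹) * Real.exp (-(φ x)^2)))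
    rw [him] at S2
    rw [hA2, S2, hA1, ← lintegral_const_mul _ (by fun_prop)]
    refine setLIntegral_congr_fun measurableSet_Ioi fun x hx => ?_
    have hx0 : 0 < x := hx
    have hs : 0 < √x := Real.sqrt_pos.2 hx0
    rw [← ENNReal.ofReal_mul (by positivity), ← ENNReal.ofReal_mul (by positivity),
      abs_neg, abs_of_pos (by positivity)]
    have e1 : √(k^2 / x) = k / √x := by rw [Real.sqrt_div (sq_nonneg k), Real.sqrt_sq hk0.le]
    have e2 : φ (k^2 / x) = - φ x := by
      simp only [hφ]
      rw [e1, hk]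
      field_simp
      ring
    rw [e2, e1, neg_sq, hk]
    congr 1
    have : x = √x ^ 2 := (Real.sq_sqrt hx0.le).symm
    generalize Real.exp (-(φ x)^2) = E
    generalize √x = w at *
    subst this
    field_simp
  rw [T1, T2, ← mul_assoc, ← ENNReal.ofReal_mul (by positivity), ← add_mul,
    ← ENNReal.ofReal_add (by positivity) (by positivity)]
  congr 2
  field_simp
  ring

lemma J_form (b : ℝ) (hb : 0 < b) : ∃ (c : ℝ≥0∞) (t : ℝ), ∀ u > 0,
    HH (-(1:ℝ)/2) (u^2 / 2) b = c * ENNReal.ofReal (1 * Real.exp (t * u)) := by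
  have hα : 0 < √b := Real.sqrt_pos.2 hb
  refine ⟨(∫⁻ t : ℝ, ENNReal.ofReal (Real.exp (-t^2))) / ENNReal.ofReal √b, -(2 * √b / √2), ?_⟩
  intro u hu
  have hκ : 0 < u / √2 := by positivity
  rw [gauss_sub √b (u / √2) hα hκ, mul_div_assoc, mul_comm (ENNReal.ofReal √b),
    ENNReal.div_mul_cancel (by simpa using hα) (by simp), mul_comm]
  unfold HH
  rw [← lintegral_const_mul _ (by fun_prop)]
  refine setLIntegral_congr_fun measurableSet_Ioi fun x hx => ?_
  have hx0 : 0 < x := hx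
  have hs : 0 < √x := Real.sqrt_pos.2 hx0
  rw [← ENNReal.ofReal_mul (by positivity)]
  congr 1
  unfold GG
  rw [show -(1:ℝ)/2 = -(1/2) by ring, Real.rpow_neg hx0.le, ← Real.sqrt_eq_rpow]
  rw [mul_left_comm, one_mul, ← Real.exp_add]
  congr 2
  have e1 := Real.sq_sqrt hx0.le
  have e2 := Real.sq_sqrt hb.le
  have e3 := Real.sq_sqrt (zero_le_two (α := ℝ))
  have e4 : (√b * √x - u / √2 / √x)^2 = √b^2 * √x^2 - 2 * √b * u / √2 + u^2 / √2^2 / √x^2 := by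
    field_simp
    ring
  rw [e4, e1, e2, e3]
  ring

lemma J_cvx (b : ℝ) (hb : 0 < b) (u₁ : ℝ) (h1 : 0 < u₁) (u₂ : ℝ) (h2 : 0 < u₂) (θ : ℝ)
    (hθ : θ ∈ Ioo (0:ℝ) 1) : HH (-(1:ℝ)/2) ((θ * u₁ + (1 - θ) * u₂)^2 / 2) b ≤
      HH (-(1:ℝ)/2) (u₁^2 / 2) b ^ θ * HH (-(1:ℝ)/2) (u₂^2 / 2) b ^ (1 - θ) := by
  obtain ⟨c, t, h⟩ := J_form b hb
  have hp : 0 < 1 - θ := by linarith [hθ.2]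
  rw [h _ h1, h _ h2, h _ (add_pos (mul_pos hθ.1 h1) (mul_pos hp h2)), mul_comm c, mul_comm c,
    mul_comm c, tilt 1 t one_pos u₁ u₂ θ c c c hθ,
    ← ENNReal.rpow_add_of_nonneg _ _ hθ.1.le hp.le]
  simp

lemma mix (lam d c : ℝ) (h1 : lam < 1) :
    ENNReal.ofReal (Real.Gamma (1 - lam) * Real.exp (0 * 0)) * HH (lam - 3/2) c d =
    ∫⁻ s in Ioi (0:ℝ), ENNReal.ofReal (s ^ (-lam)) * HH (-(1:ℝ)/2) c (d + s) := by
  have hΓ : 0 < Real.Gamma (1 - lam) := Real.Gamma_pos_of_pos (by linarith)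
  have e1 : ∫⁻ s in Ioi (0:ℝ), ENNReal.ofReal (s ^ (-lam)) * HH (-(1:ℝ)/2) c (d + s) =
      ∫⁻ s in Ioi (0:ℝ), ∫⁻ x in Ioi (0:ℝ),
        ENNReal.ofReal (GG (-(1:ℝ)/2) c d x) * ENNReal.ofReal (GG (-lam) 0 x s) := by
    refine setLIntegral_congr_fun measurableSet_Ioi fun s hs => ?_
    have hs0 : 0 < s := hs
    unfold HH
    rw [← lintegral_const_mul _ (GG_meas _ _ _).ennreal_ofReal]
    refine setLIntegral_congr_fun measurableSet_Ioi fun x hx => ?_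
    have hx0 : 0 < x := hx
    rw [← ENNReal.ofReal_mul (by positivity), ← ENNReal.ofReal_mul (GG_pos _ _ _ _ hx).le]
    congr 1
    unfold GG
    have : Real.exp (-(c / x) - (d + s) * x) =
      Real.exp (-(c / x) - d * x) * Real.exp (-(0 / s) - x * s) := by
      rw [← Real.exp_add]; congr 1; ring
    rw [this]; ring
  rw [e1, lintegral_lintegral_swap]
  · unfold HH
    rw [← lintegral_const_mul _ (GG_meas _ _ _).ennreal_ofReal]
    refine setLIntegral_congr_fun measurableSet_Ioi fun x hx => ?_
    have hx0 : 0 < x := hx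
    rw [lintegral_const_mul _ (GG_meas _ _ _).ennreal_ofReal]
    have := HH_eq (-lam) 0 x (GG_int _ _ _ le_rfl hx0.le (Or.inr (by linarith)) (Or.inl hx0))
    unfold HH at this
    rw [this]
    have e2 : ∫ s in Ioi (0:ℝ), GG (-lam) 0 x s = (1 / x) ^ (1 - lam) * Real.Gamma (1 - lam) := by
      rw [← Real.integral_rpow_mul_exp_neg_mul_Ioi (by linarith) hx0]
      unfold GG
      simp
    rw [e2, ← ENNReal.ofReal_mul (by positivity), ← ENNReal.ofReal_mul (GG_pos _ _ _ _ hx).le]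
    congr 1
    unfold GG
    rw [one_div, Real.inv_rpow hx0.le, ← Real.rpow_neg hx0.le,
      show lam - 3/2 = -(1:ℝ)/2 + -(1 - lam) by ring, Real.rpow_add hx0]
    simp
    ring
  · apply Measurable.aemeasurable
    unfold GG Function.uncurry
    fun_prop

lemma suff (lam d : ℝ) (hd : 0 < d) (hl : lam ≤ 1) (u₁ : ℝ) (h1 : 0 < u₁) (u₂ : ℝ) (h2 : 0 < u₂)
    (θ : ℝ) (hθ : θ ∈ Ioo (0:ℝ) 1) : HH (lam - 3/2) ((θ * u₁ + (1 - θ) * u₂)^2 / 2) d ≤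
      HH (lam - 3/2) (u₁^2 / 2) d ^ θ * HH (lam - 3/2) (u₂^2 / 2) d ^ (1 - θ) := by
  rcases hl.eq_or_lt with h | h
  · rw [h, show (1:ℝ) - 3/2 = -(1:ℝ)/2 by norm_num]
    exact J_cvx d hd u₁ h1 u₂ h2 θ hθ
  · have hΓ : 0 < Real.Gamma (1 - lam) := Real.Gamma_pos_of_pos (by linarith)
    have hp : 0 ≤ 1 - θ := by linarith [hθ.2]
    rw [← tilt _ 0 hΓ 0 0 θ _ _ _ hθ]
    simp only [mul_zero, add_zero]
    have M : ∀ c, ENNReal.ofReal (Real.Gamma (1 - lam) * Real.exp 0) * HH (lam - 3/2) c d =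
      ∫⁻ s in Ioi (0:ℝ), ENNReal.ofReal (s ^ (-lam)) * HH (-(1:ℝ)/2) c (d + s) := by
      intro c
      have := mix lam d c h
      rwa [mul_zero] at this
    have hm : ∀ c, Measurable fun s => HH (-(1:ℝ)/2) c (d + s) := by
      intro c
      unfold HH
      apply Measurable.lintegral_prod_right' (f := fun z : ℝ × ℝ => ENNReal.ofReal (GG (-(1:ℝ)/2) c (d + z.1) z.2))
      unfold GG
      fun_prop
    rw [M, M, M]
    refine holder _ _ _ _ ?_ ?_ θ hθ ?_
    · exact ((by fun_prop : Measurable fun s : ℝ => ENNReal.ofReal (s ^ (-lam))).mul (hm _)).aemeasurable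
    · exact ((by fun_prop : Measurable fun s : ℝ => ENNReal.ofReal (s ^ (-lam))).mul (hm _)).aemeasurable
    · refine (ae_restrict_iff' measurableSet_Ioi).2 (ae_of_all _ fun s hs => ?_)
      have hs0 : 0 < s := hs
      rw [ENNReal.mul_rpow_of_nonneg _ _ hθ.1.le, ENNReal.mul_rpow_of_nonneg _ _ hp,
        mul_mul_mul_comm, ← ENNReal.rpow_add_of_nonneg _ _ hθ.1.le hp]
      simp only [add_sub_cancel, ENNReal.rpow_one]
      gcongr
      exact J_cvx (d + s) (by linarith) u₁ h1 u₂ h2 θ hθ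



/-- Corollary 1(iv): the generalized hyperbolic density is log-convex on each of
`(-∞, μ)` and `(μ, ∞)` iff `χ = 0` (i.e. `δ = 0`) and `0 < λ ≤ 1`. -/
theorem generalized_hyperbolic_logConvex_iff
    (lam χ ψ μ β : ℝ)
    (hlam_pos : 0 < lam → 0 ≤ χ ∧ 0 < ψ)
    (hlam_zero : lam = 0 → 0 < χ ∧ 0 < ψ)
    (hlam_neg : lam < 0 → 0 < χ ∧ 0 ≤ ψ)
    (hconv : 0 < β ^ 2 + ψ ∨ lam < 1/2)
    (f : ℝ → ℝ≥0∞)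
    (hf : ∀ y, f y = ∫⁻ x in Ioi (0:ℝ), ENNReal.ofReal
      ((2 * π * x) ^ (-(1:ℝ)/2) * Real.exp (-(y - μ - β * x) ^ 2 / (2 * x)) *
        (x ^ (lam - 1) * Real.exp (-(χ / x + ψ * x) / 2)))) :
    (((∀ y ∈ Iio μ, 0 < f y ∧ f y < ⊤) ∧
        (∀ y₁ ∈ Iio μ, ∀ y₂ ∈ Iio μ, ∀ θ ∈ Ioo (0:ℝ) 1,
          f (θ * y₁ + (1 - θ) * y₂) ≤ f y₁ ^ θ * f y₂ ^ (1 - θ))) ∧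
      ((∀ y ∈ Ioi μ, 0 < f y ∧ f y < ⊤) ∧
        (∀ y₁ ∈ Ioi μ, ∀ y₂ ∈ Ioi μ, ∀ θ ∈ Ioo (0:ℝ) 1,
          f (θ * y₁ + (1 - θ) * y₂) ≤ f y₁ ^ θ * f y₂ ^ (1 - θ)))) ↔
      (χ = 0 ∧ 0 < lam ∧ lam ≤ 1) := by
  have hK : 0 < (2 * π) ^ (-(1:ℝ)/2) := by positivity
  have hff : ∀ y, f y = ENNReal.ofReal ((2 * π) ^ (-(1:ℝ)/2) * Real.exp (β * (y - μ))) *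
      HH (lam - 3/2) ((χ + (y - μ)^2) / 2) ((ψ + β^2) / 2) := fun y => by rw [hf, f_eq]
  have hψ : 0 ≤ ψ := by
    rcases lt_trichotomy lam 0 with h | h | h
    · exact (hlam_neg h).2
    · exact (hlam_zero h).2.le
    · exact (hlam_pos h).2.le
  have hd0 : 0 ≤ (ψ + β^2) / 2 := by positivity
  have hcvx : ∀ y₁ y₂ θ, θ ∈ Ioo (0:ℝ) 1 →
      (f (θ * y₁ + (1 - θ) * y₂) ≤ f y₁ ^ θ * f y₂ ^ (1 - θ) ↔
      HH (lam - 3/2) ((χ + (θ * (y₁ - μ) + (1 - θ) * (y₂ - μ))^2) / 2) ((ψ + β^2) / 2) ≤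
      HH (lam - 3/2) ((χ + (y₁ - μ)^2) / 2) ((ψ + β^2) / 2) ^ θ *
      HH (lam - 3/2) ((χ + (y₂ - μ)^2) / 2) ((ψ + β^2) / 2) ^ (1 - θ)) := by
    intro y₁ y₂ θ hθ
    rw [hff, hff y₁, hff y₂, show θ * y₁ + (1 - θ) * y₂ - μ = θ * (y₁ - μ) + (1 - θ) * (y₂ - μ) by ring]
    exact tilt _ β hK _ _ θ _ _ _ hθ
  constructor
  · rintro ⟨-, -, hc⟩
    by_contra hneg
    have hc2 : ∀ u₁ > 0, ∀ u₂ > 0, ∀ θ ∈ Ioo (0:ℝ) 1,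
        HH (lam - 3/2) ((χ + (θ * u₁ + (1 - θ) * u₂)^2) / 2) ((ψ + β^2) / 2) ≤
          HH (lam - 3/2) ((χ + u₁^2) / 2) ((ψ + β^2) / 2) ^ θ *
          HH (lam - 3/2) ((χ + u₂^2) / 2) ((ψ + β^2) / 2) ^ (1 - θ) := by
      intro u₁ h1 u₂ h2 θ hθ
      have := (hcvx (μ + u₁) (μ + u₂) θ hθ).1
        (hc _ (by simpa using h1) _ (by simpa using h2) θ hθ)
      simpa using this
    rcases lt_or_ge 0 χ with hχ | hχ
    · have hd : 0 < (ψ + β^2) / 2 ∨ lam < 1/2 := by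
        rcases hconv with h | h
        · left; linarith
        · exact Or.inr h
      refine nec (lam - 3/2) χ ((ψ + β^2) / 2) 2 one_lt_two le_rfl
        (GG_int _ _ _ (by linarith) hd0 (Or.inl (by linarith)) ?_)
        (GG_int _ _ _ (by linarith) hd0 (Or.inl (by linarith)) ?_) hc2
      · exact hd.imp id (fun h => by linarith)
      · exact hd.imp id (fun h => by linarith)
    · have hl : 0 < lam := by
        by_contra hl
        rcases (not_lt.1 hl).lt_or_eq with h | h
        · linarith [(hlam_neg h).1]
        · linarith [(hlam_zero h).1]
      have hχ0 : χ = 0 := le_antisymm hχ (hlam_pos hl).1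
      have hl1 : 1 < lam := by
        by_contra h
        exact hneg ⟨hχ0, hl, not_lt.1 h⟩
      have hd : 0 < (ψ + β^2) / 2 := by nlinarith [(hlam_pos hl).2, sq_nonneg β]
      refine nec (lam - 3/2) χ ((ψ + β^2) / 2) (min 2 lam) (lt_min one_lt_two hl1)
        (min_le_left _ _)
        (GG_int _ _ _ (by linarith) hd0 (Or.inr (by linarith)) (Or.inl hd))
        (GG_int _ _ _ (by linarith) hd0 (Or.inr ?_) (Or.inl hd)) hc2
      have := min_le_right 2 lam
      linarith
  · rintro ⟨rfl, hl, hl1⟩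
    have hd : 0 < (ψ + β^2) / 2 := by nlinarith [(hlam_pos hl).2, sq_nonneg β]
    have hfin : ∀ y, y ≠ μ → 0 < f y ∧ f y < ⊤ := by
      intro y hy
      have hy2 : 0 < (y - μ)^2 := by
        have := sub_ne_zero.2 hy
        positivity
      rw [hff]
      constructor
      · refine ENNReal.mul_pos ?_ (HH_pos _ _ _).ne'
        have : 0 < (2 * π) ^ (-(1:ℝ)/2) * Real.exp (β * (y - μ)) := by positivity
        simpa using this
      · rw [HH_eq _ _ _ (GG_int _ _ _ (by linarith) hd0 (Or.inl (by linarith)) (Or.inl hd))]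
        exact ENNReal.mul_lt_top ENNReal.ofReal_lt_top ENNReal.ofReal_lt_top
    refine ⟨⟨fun y hy => hfin y (ne_of_lt hy), ?_⟩, ⟨fun y hy => hfin y (ne_of_gt hy), ?_⟩⟩
    · intro y₁ h1 y₂ h2 θ hθ
      rw [hcvx y₁ y₂ θ hθ]
      have := suff lam _ hd hl1 (μ - y₁) (sub_pos.2 h1) (μ - y₂) (sub_pos.2 h2) θ hθ
      rw [show (θ * (μ - y₁) + (1 - θ) * (μ - y₂))^2 = (θ * (y₁ - μ) + (1 - θ) * (y₂ - μ))^2 by ring,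
        show (μ - y₁)^2 = (y₁ - μ)^2 by ring, show (μ - y₂)^2 = (y₂ - μ)^2 by ring] at this
      simpa only [zero_add] using this
    · intro y₁ h1 y₂ h2 θ hθ
      rw [hcvx y₁ y₂ θ hθ]
      simpa only [zero_add] using
        suff lam _ hd hl1 (y₁ - μ) (sub_pos.2 h1) (y₂ - μ) (sub_pos.2 h2) θ hθ
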